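/- For a finite group G, the following are equivalent: (1) maol(G) = 3; (2) G is isomorphic to the Klein four group (Z/2Z)² or to the symmetric group Sym(3) of degree 3. -/

import Mathlib

/-- `maol G` is the maximum length of an orbit of the natural action of `Aut(G)` on `G`. -/
noncomputable def maol (G : Type*) [Group G] : ℕ :=
  ⨆ g : G, Nat.card (MulAction.orbit (MulAut G) g)

/-- All automorphism orbits have at most three elements: among any four members of an orbit,
two coincide. -/
def SmallOrbits (G : Type*) [Group G] : Prop :=
  ∀ (g : G) (α β γ : MulAut G), g = α g ∨ g = β g ∨ g = γ g ∨ α g = β g ∨ α g = γ g ∨ β g = γ g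

theorem smallOrbits_of_ncard_le {G : Type*} [Group G] [Finite G]
    (h : ∀ g : G, (MulAction.orbit (MulAut G) g).ncard ≤ 3) : SmallOrbits G := by
  intro g α β γ
  by_contra! hc
  obtain ⟨h1, h2, h3, h4, h5, h6⟩ := hc
  have hsub : ({g, α g, β g, γ g} : Set G) ⊆ MulAction.orbit (MulAut G) g := by
    rintro x (rfl | rfl | rfl | rfl)
    exacts [MulAction.mem_orbit_self _, ⟨α, rfl⟩, ⟨β, rfl⟩, ⟨γ, rfl⟩]
  have hcard : ({g, α g, β g, γ g} : Set G).ncard = 4 := by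
    rw [Set.ncard_insert_of_notMem (by simp [*]), Set.ncard_insert_of_notMem (by simp [*]),
      Set.ncard_pair h6]
  have := Set.ncard_le_ncard hsub (Set.toFinite _)
  have := h g
  omega

theorem exists_three_of_orbit_ncard {G : Type*} [Group G] {a : G}
    (h : (MulAction.orbit (MulAut G) a).ncard = 3) :
    ∃ β γ : MulAut G, a ≠ β a ∧ a ≠ γ a ∧ β a ≠ γ a := by
  have hfin : (MulAction.orbit (MulAut G) a).Finite := Set.finite_of_ncard_pos (by omega)
  have key : ∀ x y : G, ∃ β : MulAut G, β a ≠ x ∧ β a ≠ y := by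
    intro x y
    by_contra! hc
    have hsub : MulAction.orbit (MulAut G) a ⊆ {x, y} := by
      rintro _ ⟨β, rfl⟩
      by_cases hx : β a = x
      · exact Or.inl hx
      · exact Or.inr (hc β hx)
    have := Set.ncard_le_ncard hsub (Set.toFinite _)
    have := Set.ncard_insert_le x {y}
    rw [Set.ncard_singleton] at this
    omega
  obtain ⟨β, hβ, -⟩ := key a a
  obtain ⟨γ, hγ, hγ'⟩ := key a (β a)
  exact ⟨β, γ, hβ.symm, hγ.symm, hγ'.symm⟩

/-- The automorphism given by an injective endomorphism of a finite group. -/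
theorem exists_mulAut_of_injective {G : Type*} [Group G] [Finite G] (f : G →* G)
    (hf : ∀ x, f x = 1 → x = 1) : ∃ α : MulAut G, ∀ x, α x = f x :=
  ⟨MulEquiv.ofBijective f
    (Finite.injective_iff_bijective.mp ((injective_iff_map_eq_one f).mpr hf)), fun _ => rfl⟩

theorem exists_mulAut_mul_central {G : Type*} [Group G] [Finite G] (χ : G →* ℤˣ) {t : G}
    (ht : ∀ x, t * x = x * t) (ht2 : t * t = 1) (hχ : χ t = 1) :
    ∃ α : MulAut G, ∀ x, α x = x * (if χ x = 1 then 1 else t) := by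
  let f : G →* G := MonoidHom.mk' (fun x => x * (if χ x = 1 then 1 else t)) (by
    intro x y
    rcases Int.units_eq_one_or (χ x) with hx | hx <;>
      rcases Int.units_eq_one_or (χ y) with hy | hy <;> simp [hx, hy, mul_assoc]
    · rw [ht]
    · rw [← mul_assoc t y, ht, mul_assoc, ht2, mul_one])
  refine exists_mulAut_of_injective f fun x hx => ?_
  change x * (if χ x = 1 then 1 else t) = 1 at hx
  split_ifs at hx with h
  · simpa using hx
  · have : x = t := by rw [← mul_left_inj t, hx, ht2]
    rw [this] at h
    exact absurd hχ h

theorem isConj_of_smallOrbits {G : Type*} [Group G] (hO : SmallOrbits G) {x h : G}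
    (hx : h * x * h⁻¹ ≠ x) (α : MulAut G) : ∃ k, α x = k * x * k⁻¹ := by
  rcases hO x (MulAut.conj h) α ((MulAut.conj h).trans α) with e | e | e | e | e | e
  · exact absurd e.symm (by simpa using hx)
  · exact ⟨1, by simp [← e]⟩
  · refine ⟨(α h)⁻¹, ?_⟩
    have : x = α h * α x * (α h)⁻¹ := by simpa using e
    conv_rhs => rw [this]
    group
  · exact ⟨h, by simpa using e.symm⟩
  · refine ⟨(α h)⁻¹ * h, ?_⟩
    have : h * x * h⁻¹ = α h * α x * (α h)⁻¹ := by simpa using e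
    have h2 : α x = (α h)⁻¹ * (α h * α x * (α h)⁻¹) * α h := by group
    rw [h2, ← this]
    group
  · refine absurd ?_ hx
    have : α x = α (h * x * h⁻¹) := by simpa using e
    exact (α.injective this).symm

theorem false_of_central_orbit {G : Type*} [Group G] (hO : SmallOrbits G) {a g k h : G}
    (ha : ∀ x, a * x = x * a) (hk : h * g * h⁻¹ = k) (hkg : k ≠ g)
    (hcl : ∀ y, y * g * y⁻¹ = g ∨ y * g * y⁻¹ = k)
    {β γ : MulAut G} (h1 : a ≠ β a) (h2 : a ≠ γ a) (h3 : β a ≠ γ a) : False := by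
  have hA : ∀ α : MulAut G, α a = a ∨ α a = g⁻¹ * k * a ∨ α a = (g⁻¹ * k)⁻¹ * a := by
    intro α
    have hga : h * (g * a) * h⁻¹ ≠ g * a := by
      rw [← mul_assoc, mul_assoc (h * g), ha, ← mul_assoc, hk]
      simpa using hkg
    obtain ⟨y, hy⟩ := isConj_of_smallOrbits hO (hk ▸ hkg) α
    obtain ⟨y', hy'⟩ := isConj_of_smallOrbits hO hga α
    have e : y' * (g * a) * y'⁻¹ = y' * g * y'⁻¹ * a := by
      rw [← mul_assoc, mul_assoc (y' * g), ha, ← mul_assoc]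
    rw [e, map_mul, hy] at hy'
    rcases hcl y with e1 | e1 <;> rcases hcl y' with e2 | e2 <;> rw [e1, e2] at hy'
    · exact Or.inl (by simpa using hy')
    · exact Or.inr (Or.inl (by rw [mul_assoc, ← hy']; group))
    · exact Or.inr (Or.inr (by rw [mul_inv_rev, inv_inv, mul_assoc, ← hy']; group))
    · exact Or.inl (by simpa using hy')
  have hcent : ∀ (α : MulAut G) x, α a * x = x * α a := by
    intro α x
    have := congrArg α (ha (α.symm x))
    simpa using this
  have hz : ∃ α : MulAut G, α a = g⁻¹ * k * a := by
    rcases hA β with e | e | e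
    · exact absurd e.symm h1
    · exact ⟨β, e⟩
    · rcases hA γ with e' | e' | e'
      · exact absurd e'.symm h2
      · exact ⟨γ, e'⟩
      · exact absurd (e.trans e'.symm) h3
  have hzc : ∀ x, (g⁻¹ * k) * x = x * (g⁻¹ * k) := by
    obtain ⟨α, hα⟩ := hz
    intro x
    have := hcent α x
    rw [hα, mul_assoc, ha, ← mul_assoc, ← mul_assoc] at this
    exact mul_right_cancel this
  generalize hzdef : g⁻¹ * k = z at *
  have hkz : k = g * z := by rw [← hzdef]; group
  have hz2 : z * z = 1 := by
    have e : (h * h) * g * (h * h)⁻¹ = g * (z * z) := by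
      have : (h * h) * g * (h * h)⁻¹ = h * (h * g * h⁻¹) * h⁻¹ := by group
      rw [this, hk, hkz, ← mul_assoc, mul_assoc (h * g), hzc, ← mul_assoc, hk, hkz, mul_assoc]
    rcases hcl (h * h) with e1 | e1
    · simpa using e.symm.trans e1
    · rw [e, hkz] at e1
      simp only [mul_right_inj, mul_eq_left] at e1
      simp [e1]
  have hzi : z⁻¹ = z := inv_eq_of_mul_eq_one_left hz2
  rw [hzi] at hA
  rcases hA β with e | e | e <;> rcases hA γ with e' | e' | e' <;>
    first | exact h1 e.symm | exact h2 e'.symm | exact h3 (e.trans e'.symm)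

theorem exists_quadratic_character {G : Type*} [CommGroup G] {a : G} (ha : ∀ u : G, u ^ 2 ≠ a) :
    ∃ χ : G →* ℤˣ, χ a = -1 := by
  let W : Subgroup G := (powMonoidHom 2 : G →* G).range
  have h2 : ∀ x : Additive (G ⧸ W), 2 • x = 0 := by
    intro x
    induction x using Additive.rec with | ofMul x => ?_
    induction x using QuotientGroup.induction_on with | H x => ?_
    rw [← ofMul_pow, ← QuotientGroup.mk_pow]
    exact congrArg Additive.ofMul ((QuotientGroup.eq_one_iff _).mpr ⟨x, rfl⟩)
  let _ : Module (ZMod 2) (Additive (G ⧸ W)) := AddCommGroup.zmodModule h2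
  have hne : Additive.ofMul (a : G ⧸ W) ≠ 0 := by
    intro h
    obtain ⟨u, hu⟩ := (QuotientGroup.eq_one_iff a).mp (congrArg Additive.toMul h)
    exact ha u hu
  obtain ⟨f, hf⟩ : ∃ f : Module.Dual (ZMod 2) (Additive (G ⧸ W)), f (Additive.ofMul (a : G ⧸ W)) ≠ 0 := by
    by_contra! hc
    exact hne ((Module.forall_dual_apply_eq_zero_iff (ZMod 2) _).mp hc)
  refine ⟨MonoidHom.mk' (fun x => if f (Additive.ofMul (x : G ⧸ W)) = 0 then 1 else -1) ?_, ?_⟩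
  · intro x y
    rw [QuotientGroup.mk_mul, ofMul_mul, map_add]
    generalize f (Additive.ofMul (x : G ⧸ W)) = p
    generalize f (Additive.ofMul (y : G ⧸ W)) = q
    revert p q
    decide
  · exact if_neg hf

theorem apply_eq_self_of_pow_eq {G : Type*} [Group G] (hO : SmallOrbits G) {a x : G} {n : ℕ}
    (hx : x ^ n = a) {β γ : MulAut G} (h1 : a ≠ β a) (h2 : a ≠ γ a) (h3 : β a ≠ γ a)
    {α : MulAut G} (hα : (α x) ^ n = a) : α x = x := by
  have hp : ∀ δ : MulAut G, (δ x) ^ n = δ a := fun δ => by rw [← map_pow, hx]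
  rcases hO x α β γ with e | e | e | e | e | e
  · exact e.symm
  · exact absurd (by rw [← hp, ← e, hx]) h1
  · exact absurd (by rw [← hp, ← e, hx]) h2
  · exact absurd (by rw [← hp, ← e, hα]) h1
  · exact absurd (by rw [← hp, ← e, hα]) h2
  · exact absurd (by rw [← hp, ← hp, e]) h3

theorem isKleinFour_of_smallOrbits {G : Type*} [CommGroup G] [Finite G] (hO : SmallOrbits G)
    {a : G} {β γ : MulAut G} (h1 : a ≠ β a) (h2 : a ≠ γ a) (h3 : β a ≠ γ a) : IsKleinFour G := by
  have hinv : ∀ x : G, MulEquiv.inv G x = x⁻¹ := fun _ => rfl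
  have ha1 : a ≠ 1 := by
    rintro rfl
    simp at h1
  have ha2 : a * a = 1 := by
    have key : ∀ x : G, x = x⁻¹ → x * x = 1 := fun x hx =>
      (eq_inv_iff_mul_eq_one).mp hx
    have back : ∀ δ : MulAut G, δ a * δ a = 1 → a * a = 1 := fun δ h =>
      δ.injective (by rw [map_mul, h, map_one])
    by_contra hne
    have hne' : ∀ δ : MulAut G, δ a ≠ (δ a)⁻¹ := fun δ h => hne (back δ (key _ h))
    have hi : ∀ δ : MulAut G, δ a = a ∨ δ a = β a ∨ δ a = γ a := by
      intro δ
      rcases hO a β γ δ with e | e | e | e | e | e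
      · exact absurd e h1
      · exact absurd e h2
      · exact Or.inl e.symm
      · exact absurd e h3
      · exact Or.inr (Or.inl e.symm)
      · exact Or.inr (Or.inr e.symm)
    have n0 : a ≠ a⁻¹ := hne' 1
    have nβ := hne' β
    have nγ := hne' γ
    have i0 := hi (MulEquiv.inv G)
    have iβ := hi (β.trans (MulEquiv.inv G))
    have iγ := hi (γ.trans (MulEquiv.inv G))
    simp only [hinv, MulEquiv.trans_apply] at i0 iβ iγ
    revert n0 nβ nγ i0 iβ iγ h1 h2 h3
    clear * -
    generalize β a = b
    generalize γ a = c
    intro h1 h2 h3 n0 nb nc i0 ib ic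
    have inv_inv' : ∀ {x y : G}, x⁻¹ = y → y⁻¹ = x := fun h => by rw [← h, inv_inv]
    rcases i0 with e | e | e
    · exact n0 e.symm
    · rcases ic with e' | e' | e'
      · exact h3 (e.symm.trans (inv_inv' e'))
      · exact h2 ((inv_inv' e).symm.trans (inv_inv' e'))
      · exact nc e'.symm
    · rcases ib with e' | e' | e'
      · exact h3 ((inv_inv' e').symm.trans e)
      · exact nb e'.symm
      · exact h1 ((inv_inv' e).symm.trans (inv_inv' e'))
  have hns : ∀ u : G, u ^ 2 ≠ a := by
    intro u hu
    have hi : MulEquiv.inv G u = u := apply_eq_self_of_pow_eq hO hu h1 h2 h3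
      (by rw [hinv, inv_pow, hu]; exact inv_eq_of_mul_eq_one_left ha2)
    rw [hinv] at hi
    apply ha1
    rw [← hu, pow_two]
    exact eq_inv_iff_mul_eq_one.mp hi.symm
  obtain ⟨χ, hχ⟩ := exists_quadratic_character hns
  have hker : ∀ t : G, t * t = 1 → χ t = 1 → t = 1 ∨ a * t = β a ∨ a * t = γ a := by
    intro t ht hχt
    obtain ⟨α, hα⟩ := exists_mulAut_mul_central χ (fun x => mul_comm t x) ht hχt
    have hαa : α a = a * t := by rw [hα, hχ]; simp
    rcases hO a β γ α with e | e | e | e | e | e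
    · exact absurd e h1
    · exact absurd e h2
    · exact Or.inl (by simpa [hαa] using e)
    · exact absurd e h3
    · exact Or.inr (Or.inl (by rw [e, hαa]))
    · exact Or.inr (Or.inr (by rw [e, hαa]))
  set b := β a with hb
  set c := γ a with hc
  have hb2 : b * b = 1 := by rw [hb, ← map_mul, ha2, map_one]
  have hc2 : c * c = 1 := by rw [hc, ← map_mul, ha2, map_one]
  have hb1 : b ≠ 1 := by simpa [hb] using ha1
  have hc1 : c ≠ 1 := by simpa [hc] using ha1
  have haa : ∀ t, a * (a * t) = t := fun t => by rw [← mul_assoc, ha2, one_mul]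
  have hbb : ∀ t, b * (b * t) = t := fun t => by rw [← mul_assoc, hb2, one_mul]
  have hcc : ∀ t, c * (c * t) = t := fun t => by rw [← mul_assoc, hc2, one_mul]
  have hall : ∀ t : G, t * t = 1 → t = 1 ∨ t = a ∨ t = b ∨ t = c ∨ t = a * b ∨ t = a * c := by
    intro t ht
    rcases Int.units_eq_one_or (χ t) with e | e
    · rcases hker t ht e with e | e | e
      · exact Or.inl e
      · rw [← e, haa]; simp
      · rw [← e, haa]; simp
    · rcases hker (a * t) (by rw [mul_mul_mul_comm, ha2, ht, one_mul]) (by simp [hχ, e]) with e | e | e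
      · exact Or.inr (Or.inl (by rw [← haa t, e, mul_one]))
      · rw [haa] at e; simp [e]
      · rw [haa] at e; simp [e]
  have hbc : b * c = a := by
    rcases hall (b * c) (by rw [mul_mul_mul_comm, hb2, hc2, one_mul]) with e | e | e | e | e | e
    · exact absurd (by rw [← hbb c, e, mul_one]) h3
    · exact e
    · exact absurd (by simpa using e) hc1
    · exact absurd (by simpa using e) hb1
    · rw [mul_comm a b] at e
      exact absurd (mul_left_cancel e).symm h2
    · exact absurd (mul_right_cancel e).symm h1
  have hV : ∀ t : G, t * t = 1 → t = 1 ∨ t = a ∨ t = b ∨ t = c := by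
    intro t ht
    have hab : a * b = c := by rw [← hbc, mul_comm, hbb]
    have hac : a * c = b := by rw [← hbc, mul_assoc, hc2, mul_one]
    have := hall t ht
    rw [hab, hac] at this
    tauto
  have hsq : ∀ u : G, (u ^ 2) ^ 2 = 1 → u ^ 2 = 1 := by
    intro u hu
    rcases hV (u ^ 2) (by rw [← pow_two, hu]) with e | e | e | e
    · exact e
    · exact absurd e (hns u)
    · exact absurd (by rw [← map_pow, e, hb]; simp) (hns (β.symm u))
    · exact absurd (by rw [← map_pow, e, hc]; simp) (hns (γ.symm u))
  have hpow : ∀ (k : ℕ) (u : G), u ^ 2 ^ k = 1 → u ^ 2 = 1 := by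
    intro k
    induction k with
    | zero => intro u hu; rw [pow_zero, pow_one] at hu; rw [hu, one_pow]
    | succ k ih =>
      intro u hu
      rw [pow_succ', pow_mul] at hu
      exact hsq u (ih _ hu)
  obtain ⟨k, m, hm, hkm⟩ := Nat.exists_eq_two_pow_mul_odd (n := Nat.card G) Nat.card_pos.ne'
  have hm2 : ∀ u : G, (u ^ 2) ^ m = 1 := by
    intro u
    rw [← pow_mul, mul_comm, pow_mul]
    apply hpow k
    rw [← pow_mul, mul_comm, ← hkm, pow_card_eq_one']
  have ham : a ^ m = a := by
    obtain ⟨j, rfl⟩ := hm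
    rw [pow_succ, pow_mul, pow_two, ha2, one_pow, one_mul]
  have hexp : ∀ u : G, u * u = 1 := by
    intro u
    have hai : a⁻¹ = a := inv_eq_of_mul_eq_one_left ha2
    have e : MulEquiv.inv G (u ^ 2 * a) = u ^ 2 * a :=
      apply_eq_self_of_pow_eq hO (n := m) (by rw [mul_pow, hm2, one_mul, ham]) h1 h2 h3
        (by rw [hinv, inv_pow, mul_pow, hm2, one_mul, ham, hai])
    rw [hinv, mul_inv_rev, hai, mul_comm, mul_right_cancel_iff] at e
    rw [← pow_two]
    apply hsq
    rw [pow_two (u ^ 2)]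
    exact eq_inv_iff_mul_eq_one.mp e.symm
  refine ⟨?_, ?_⟩
  · have : (Set.univ : Set G) = {1, a, b, c} := by
      ext t
      simpa using hV t (hexp t)
    rw [← Set.ncard_univ, this, Set.ncard_insert_of_notMem, Set.ncard_insert_of_notMem,
      Set.ncard_pair h3]
    · simp [h1, h2]
    · simp [ha1.symm, hb1.symm, hc1.symm]
  · have : Nontrivial G := ⟨a, 1, ha1⟩
    exact (Monoid.exponent_eq_prime_iff Nat.prime_two).mpr fun g hg =>
      orderOf_eq_prime (by rw [pow_two, hexp]) hg

theorem pow_val_add {G : Type*} [Group G] {w : G} (hw : w ^ 3 = 1) (a b : ZMod 3) :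
    w ^ (a + b).val = w ^ a.val * w ^ b.val := by
  rw [ZMod.val_add, ← pow_add, ← pow_eq_pow_mod _ hw]

theorem pow_val_eq_one {G : Type*} [Group G] {z : G} (hz : z ^ 3 = 1) (hz1 : z ≠ 1) {a : ZMod 3}
    (h : z ^ a.val = 1) : a = 0 := by
  rw [← ZMod.val_eq_zero]
  have hd := orderOf_dvd_of_pow_eq_one h
  rw [orderOf_eq_prime hz hz1] at hd
  exact Nat.eq_zero_of_dvd_of_lt hd (ZMod.val_lt a)

theorem apply_eq_mul_pow {G : Type*} [Group G] (hO : SmallOrbits G) {z u v : G}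
    (hzc : ∀ h, z * h = h * z) (hz : z ^ 3 = 1) (hz1 : z ≠ 1) (h : u * v = v * u * z)
    (α : MulAut G) : ∃ i : ZMod 3, α u = u * z ^ i.val := by
  have c1 : MulAut.conj v⁻¹ u = u * z := by
    rw [MulAut.conj_apply, inv_inv, mul_assoc, h]; group
  have c2 : MulAut.conj (v⁻¹ * v⁻¹) u = u * z ^ 2 := by
    rw [map_mul, MulAut.mul_apply, c1, map_mul, c1, MulAut.conj_apply, inv_inv, mul_assoc, mul_assoc v⁻¹,
      hzc v]
    group
    norm_cast
    rw [mul_assoc, ← pow_two]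
  have hz2 : z ^ 2 ≠ 1 := fun h2 => hz1 (by rw [← hz, pow_succ, h2, one_mul])
  rcases hO u (MulAut.conj v⁻¹) (MulAut.conj (v⁻¹ * v⁻¹)) α with e | e | e | e | e | e
  · rw [c1] at e; exact absurd (by simpa using e) hz1
  · rw [c2] at e; exact absurd (by simpa using e) hz2
  · exact ⟨0, by simp [← e]⟩
  · rw [c1, c2, pow_two] at e; exact absurd (by simpa using e) hz1
  · exact ⟨1, by rw [← e, c1, show (1 : ZMod 3).val = 1 from rfl, pow_one]⟩
  · exact ⟨2, by rw [← e, c2, show (2 : ZMod 3).val = 2 from rfl]⟩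

theorem exists_commutator_hom {G : Type*} [Group G] (hO : SmallOrbits G) {z y v : G}
    (hzc : ∀ h, z * h = h * z) (hz : z ^ 3 = 1) (hz1 : z ≠ 1) (h : y * v = v * y * z) :
    ∃ φ : G → ZMod 3, (∀ a b, φ (a * b) = φ a + φ b) ∧ ∀ a, y * a = a * y * z ^ (φ a).val := by
  have key : ∀ a : G, ∃ i : ZMod 3, y * a = a * y * z ^ i.val := by
    intro a
    obtain ⟨i, hi⟩ := apply_eq_mul_pow hO hzc hz hz1 h (MulAut.conj a⁻¹)
    refine ⟨i, ?_⟩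
    rw [mul_assoc, ← hi, MulAut.conj_apply]
    group
  choose φ hφ using key
  refine ⟨φ, fun a b => ?_, hφ⟩
  have hzp : ∀ (n : ℕ) k, z ^ n * k = k * z ^ n := fun n k => (show Commute z k from hzc k).pow_left n
  have e : y * (a * b) = a * b * y * z ^ (φ a + φ b).val := by
    rw [← mul_assoc, hφ a, mul_assoc, hzp, ← mul_assoc, mul_assoc a, hφ b, pow_val_add hz,
      mul_assoc, mul_assoc, mul_assoc, mul_assoc, mul_assoc, ← hzp]
  have e' : z ^ (φ (a * b)).val = z ^ (φ a + φ b).val := mul_left_cancel ((hφ (a * b)).symm.trans e)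
  have e2 : z ^ (φ (a * b) - (φ a + φ b)).val = 1 := by
    have := pow_val_add hz (φ (a * b) - (φ a + φ b)) (φ a + φ b)
    rw [sub_add_cancel, e'] at this
    simpa using this
  exact sub_eq_zero.mp (pow_val_eq_one hz hz1 e2)

theorem mul_twist_mul_twist {G : Type*} [Group G] {a b u v p q r : G}
    (hp : ∀ x, p * x = x * p) (hq : ∀ x, q * x = x * q) (h : u * b = b * u * p) :
    a * b * (u * v) * (p * (q * r)) = a * u * q * (b * v * r) := by
  calc a * b * (u * v) * (p * (q * r)) = a * (b * u) * (v * p) * (q * r) := by group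
    _ = a * (b * u * p) * (v * q) * r := by rw [← hp v]; group
    _ = a * u * (b * (v * q)) * r := by rw [← h]; group
    _ = a * u * q * (b * v * r) := by rw [← mul_assoc b, ← hq (b * v)]; group

theorem exists_mulAut_of_commutator_hom {G : Type*} [Group G] [Finite G] {z w : G} {e : ZMod 3}
    (hzc : ∀ h, z * h = h * z) (hz : z ^ 3 = 1) (hw : w ^ 3 = 1)
    {φ : G → ZMod 3} (hφ : ∀ a b, φ (a * b) = φ a + φ b)
    (hwφ : ∀ a, w * a = a * w * z ^ (e * φ a).val) (hφw : φ w = 0) (hφz : φ z = 0) :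
    ∃ α : MulAut G, ∀ h, α h = h * w ^ (φ h).val * z ^ (2 * e * φ h * φ h).val := by
  have hzp : ∀ (n : ℕ) k, z ^ n * k = k * z ^ n := fun n k => (show Commute z k from hzc k).pow_left n
  have hwn : ∀ (n : ℕ) a, w ^ n * a = a * w ^ n * z ^ (n * e * φ a).val := by
    intro n a
    induction n with
    | zero => simp
    | succ n ih =>
      have : ((n + 1 : ℕ) * e * φ a : ZMod 3) = n * e * φ a + e * φ a := by push_cast; ring
      rw [this, pow_val_add hz, pow_succ', mul_assoc, ih, ← mul_assoc, ← mul_assoc, hwφ,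
        mul_assoc (a * w), hzp, hzp]
      simp only [mul_assoc]
  have hφ1 : φ 1 = 0 := by simpa using hφ 1 1
  have hφp : ∀ (n : ℕ) {a : G}, φ a = 0 → φ (a ^ n) = 0 := by
    intro n a ha
    induction n with
    | zero => simpa using hφ1
    | succ n ih => rw [pow_succ, hφ, ih, ha, add_zero]
  refine exists_mulAut_of_injective
    (MonoidHom.mk' (fun h => h * w ^ (φ h).val * z ^ (2 * e * φ h * φ h).val) fun a b => ?_)
    fun h hh => ?_
  · have h1 : 2 * e * φ (a * b) * φ (a * b) =
        φ a * e * φ b + (2 * e * φ a * φ a + 2 * e * φ b * φ b) := by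
      rw [hφ]
      generalize φ a = p
      generalize φ b = q
      clear * -
      revert p q e
      decide
    have h2 := hwn (φ a).val b
    rw [ZMod.natCast_zmod_val] at h2
    rw [h1, pow_val_add hz, pow_val_add hz, hφ, pow_val_add hw]
    exact mul_twist_mul_twist (hzp _) (hzp _) h2
  · change h * w ^ (φ h).val * z ^ (2 * e * φ h * φ h).val = 1 at hh
    have h0 := congrArg φ hh
    rw [hφ, hφ, hφp _ hφw, hφp _ hφz, hφ1, add_zero, add_zero] at h0
    simpa [h0] using hh

theorem false_of_pow_three_eq_one {G : Type*} [Group G] [Finite G] (hO : SmallOrbits G)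
    {z y v : G} (hzc : ∀ h, z * h = h * z) (hz : z ^ 3 = 1) (hz1 : z ≠ 1)
    (h : y * v = v * y * z) (hy : y ^ 3 = 1) : False := by
  obtain ⟨φ, hφ, hyφ⟩ := exists_commutator_hom hO hzc hz hz1 h
  have hφ0 : ∀ a, y * a = a * y → φ a = 0 := fun a ha =>
    pow_val_eq_one hz hz1 (by simpa [ha] using hyφ a)
  obtain ⟨α, hα⟩ := exists_mulAut_of_commutator_hom (e := 1) hzc hz hy hφ
    (by simpa using hyφ) (hφ0 y rfl) (hφ0 z (hzc y).symm)
  have hzp : ∀ (n : ℕ) k, z ^ n * k = k * z ^ n := fun n k => (show Commute z k from hzc k).pow_left n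
  have hz21 : z ^ 2 ≠ 1 := fun h2 => hz1 (by rw [← hz, pow_succ, h2, one_mul])
  obtain ⟨i, hi⟩ := apply_eq_mul_pow hO (z := z ^ 2) (u := v) (v := y) (hzp 2)
    (by rw [← pow_mul, mul_comm, pow_mul, hz, one_pow]) hz21
    (by rw [h, mul_assoc, ← pow_succ', hz, mul_one]) α
  have hv1 : φ v = 1 := by
    have e : z ^ (φ v).val = z := mul_left_cancel ((hyφ v).symm.trans h)
    have := pow_val_add hz (φ v - 1) 1
    rw [sub_add_cancel, e, show (1 : ZMod 3).val = 1 from rfl, pow_one] at this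
    exact sub_eq_zero.mp (pow_val_eq_one hz hz1 (by simpa using this.symm))
  rw [hα, hv1, show (1 : ZMod 3).val = 1 from rfl, pow_one, mul_assoc, mul_right_inj] at hi
  have hyc : y * v = v * y := by
    have : y = (z ^ 2) ^ i.val * (z ^ (2 * 1 * 1 * 1 : ZMod 3).val)⁻¹ := by rw [← hi]; group
    have c1 : Commute ((z ^ 2) ^ i.val * (z ^ (2 * 1 * 1 * 1 : ZMod 3).val)⁻¹) v :=
      (((show Commute z v from hzc v).pow_left 2).pow_left _).mul_left
        ((show Commute z v from hzc v).pow_left _).inv_left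
    rw [← this] at c1
    exact c1
  rw [hyc] at h
  exact hz1 (by simpa using h)

theorem mul_pow_three_of_central {G : Type*} [Group G] {x q s : G} (hs : ∀ h, s * h = h * s)
    (hs3 : s ^ 3 = 1) (h : q * x = x * q * s) : (x * q) ^ 3 = x ^ 3 * q ^ 3 := by
  have h2 : q * q * x = x * (q * q * (s * s)) := by
    rw [mul_assoc, h, ← mul_assoc, ← mul_assoc, h, mul_assoc (x * q), hs q]
    simp only [mul_assoc]
  calc (x * q) ^ 3 = x * (q * x) * q * x * q := by simp only [pow_succ, pow_zero, one_mul, mul_assoc]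
    _ = x * x * q * (s * q) * x * q := by rw [h]; simp only [mul_assoc]
    _ = x * x * (q * q) * (s * (x * q)) := by rw [hs q]; simp only [mul_assoc]
    _ = x * x * (q * q * x) * (q * s) := by rw [hs (x * q)]; simp only [mul_assoc]
    _ = x * x * x * q * q * (s * s * q) * s := by rw [h2]; simp only [mul_assoc]
    _ = x * x * x * q * q * q * s ^ 3 := by
      rw [mul_assoc s s q, hs q, ← mul_assoc s q s, hs q]
      simp only [pow_succ, pow_zero, one_mul, mul_assoc]
    _ = _ := by rw [hs3]; simp only [pow_succ, pow_zero, one_mul, mul_assoc, mul_one]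

theorem false_of_central_commutator {G : Type*} [Group G] [Finite G] (hO : SmallOrbits G)
    {z g x : G} (hzc : ∀ h, z * h = h * z) (hz : z ^ 3 = 1) (hz1 : z ≠ 1)
    (h : g * x = x * g * z) : False := by
  have hzp : ∀ (n : ℕ) k, z ^ n * k = k * z ^ n := fun n k => (show Commute z k from hzc k).pow_left n
  have hzn3 : ∀ n : ℕ, (z ^ n) ^ 3 = 1 := fun n => by
    rw [← pow_mul, mul_comm, pow_mul, hz, one_pow]
  have hz21 : z ^ 2 ≠ 1 := fun h2 => hz1 (by rw [← hz, pow_succ, h2, one_mul])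
  have hx : x * g = g * x * z ^ 2 := by rw [h, mul_assoc, ← pow_succ', hz, mul_one]
  have hcube : ∀ {u v c : G}, (∀ k, c * k = k * c) → c ^ 3 = 1 → c ≠ 1 → u * v = v * u * c →
      ∀ k, k * u ^ 3 = u ^ 3 * k := by
    intro u v c hc hc3 hc1 huv k
    obtain ⟨i, hi⟩ := apply_eq_mul_pow hO hc hc3 hc1 huv (MulAut.conj k)
    have e : MulAut.conj k (u ^ 3) = u ^ 3 := by
      rw [map_pow, hi, Commute.mul_pow ((show Commute c u from hc u).pow_left _).symm,
        ← pow_mul, mul_comm, pow_mul, hc3, one_pow, mul_one]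
    rwa [MulAut.conj_apply, mul_inv_eq_iff_eq_mul] at e
  have hg3 := hcube hzc hz hz1 h
  have hx3 := hcube (hzp 2) (hzn3 2) hz21 hx
  have htors : ∀ t : G, (∀ k, t * k = k * t) → t ^ 3 = 1 → t ∈ Subgroup.zpowers z := by
    intro t htc ht
    obtain ⟨φ, hφ, hgφ⟩ := exists_commutator_hom hO hzc hz hz1 h
    have hφ0 : ∀ a, g * a = a * g → φ a = 0 := fun a ha =>
      pow_val_eq_one hz hz1 (by simpa [ha] using hgφ a)
    obtain ⟨α, hα⟩ := exists_mulAut_of_commutator_hom (e := 0) hzc hz ht hφ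
      (fun a => by simpa using htc a) (hφ0 t (htc g).symm) (hφ0 z (hzc g).symm)
    have hx1 : φ x = 1 := by
      have e : z ^ (φ x).val = z := mul_left_cancel ((hgφ x).symm.trans h)
      have := pow_val_add hz (φ x - 1) 1
      rw [sub_add_cancel, e, show (1 : ZMod 3).val = 1 from rfl, pow_one] at this
      exact sub_eq_zero.mp (pow_val_eq_one hz hz1 (by simpa using this.symm))
    obtain ⟨i, hi⟩ := apply_eq_mul_pow hO (hzp 2) (hzn3 2) hz21 hx α
    rw [hα, hx1, show (1 : ZMod 3).val = 1 from rfl, pow_one, mul_assoc, mul_right_inj] at hi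
    have ht' : t = (z ^ 2) ^ i.val := by simpa using hi
    rw [ht']
    exact pow_mem (pow_mem (Subgroup.mem_zpowers z) _) _
  let c : Subgroup.center G →* Subgroup.center G := MonoidHom.mk' (· ^ 3) fun a b =>
    Commute.mul_pow (Subtype.ext (Subgroup.mem_center_iff.mp b.2 a)) 3
  have hmem : ∀ {t : G}, (∀ k, k * t = t * k) → t ∈ Subgroup.center G := fun ht => Subgroup.mem_center_iff.mpr ht
  let zZ : Subgroup.center G := ⟨z, hmem fun k => (hzc k).symm⟩
  have hzZ : zZ ^ 3 = 1 := Subtype.ext hz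
  have hker : Nat.card c.ker = 3 := by
    have : c.ker = Subgroup.zpowers zZ := by
      apply le_antisymm
      · intro t ht
        obtain ⟨k, hk⟩ := htors t.1 (fun k => ((Subgroup.mem_center_iff.mp t.2) k).symm)
          (congrArg Subtype.val (show t ^ 3 = 1 from ht))
        exact ⟨k, Subtype.ext hk⟩
      · rw [Subgroup.zpowers_le]
        exact hzZ
    rw [this, Nat.card_zpowers]
    exact orderOf_eq_prime hzZ fun e => hz1 (congrArg Subtype.val e)
  have hidx : Nat.card (Subgroup.center G ⧸ c.range) = 3 := by
    have h1 := c.range.card_mul_index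
    have h2 := c.ker.card_mul_index
    rw [Subgroup.index_ker, hker] at h2
    rw [← h2, mul_comm] at h1
    exact Nat.eq_of_mul_eq_mul_right Nat.card_pos h1
  let g3 : Subgroup.center G := ⟨g ^ 3, hmem hg3⟩
  let x3 : Subgroup.center G := ⟨x ^ 3, hmem hx3⟩
  have hcut : ∀ {u : G} (u3 : Subgroup.center G), u ^ 3 = u3 → (u3 : Subgroup.center G ⧸ c.range) = 1 →
      ∃ d : G, (∀ k, d * k = k * d) ∧ (u * d) ^ 3 = 1 := by
    intro u u3 hu hu3
    obtain ⟨d, hd⟩ := (QuotientGroup.eq_one_iff u3).mp hu3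
    have hdc : ∀ k, (d⁻¹ : Subgroup.center G).1 * k = k * (d⁻¹ : Subgroup.center G).1 :=
      fun k => ((Subgroup.mem_center_iff.mp (d⁻¹ : Subgroup.center G).2) k).symm
    refine ⟨(d⁻¹ : Subgroup.center G), hdc, ?_⟩
    rw [Commute.mul_pow (show Commute _ _ from (hdc u).symm), hu, ← hd]
    change ((d ^ 3 * d⁻¹ ^ 3 : Subgroup.center G) : G) = 1
    simp
  by_cases hq : (g3 : Subgroup.center G ⧸ c.range) = 1
  · obtain ⟨d, hd, hgd⟩ := hcut (u := g) g3 rfl hq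
    refine false_of_pow_three_eq_one hO hzc hz hz1 (y := g * d) (v := x) ?_ hgd
    rw [mul_assoc, hd, ← mul_assoc, h, mul_assoc, hzc]
    group
  · have : Fact (Nat.Prime 3) := ⟨Nat.prime_three⟩
    obtain ⟨m, hm⟩ := mem_powers_of_prime_card hidx hq (g' := ((x3 : Subgroup.center G ⧸ c.range))⁻¹)
    have hgm : ∀ n : ℕ, g ^ n * x = x * g ^ n * z ^ n := by
      intro n
      induction n with
      | zero => simp
      | succ n ih =>
        rw [pow_succ', mul_assoc, ih, ← mul_assoc, ← mul_assoc, h, pow_succ' z, mul_assoc (x * g),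
          hzc (g ^ n)]
        group
    have hxg : (x * g ^ m) ^ 3 = ((x3 * g3 ^ m : Subgroup.center G) : G) := by
      rw [mul_pow_three_of_central (hzp m) (hzn3 m) (hgm m), ← pow_mul, mul_comm m, pow_mul]
      rfl
    obtain ⟨d, hd, hxd⟩ := hcut (x3 * g3 ^ m) hxg (by
      rw [QuotientGroup.mk_mul, QuotientGroup.mk_pow]
      change (g3 : Subgroup.center G ⧸ c.range) ^ m = _ at hm
      rw [hm, mul_inv_cancel])
    refine false_of_pow_three_eq_one hO (hzp 2) (hzn3 2) hz21 (y := x * g ^ m * d) (v := g) ?_ hxd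
    calc x * g ^ m * d * g = x * g ^ m * (d * g) := by group
      _ = x * g * (g ^ m * d) := by rw [hd]; group
      _ = g * x * (z ^ 2 * (g ^ m * d)) := by rw [hx]; group
      _ = _ := by rw [hzp]; group

theorem false_of_centralizer_normal {G : Type*} [Group G] [Finite G] (hO : SmallOrbits G) {g : G}
    (hN : (Subgroup.centralizer {g}).Normal) (hi : (Subgroup.centralizer {g}).index = 3) :
    False := by
  have hmem : ∀ y, y ∈ Subgroup.centralizer {g} ↔ g * y = y * g := fun y => by
    rw [Subgroup.mem_centralizer_singleton_iff, eq_comm]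
  obtain ⟨x, hx⟩ : ∃ x, x ∉ Subgroup.centralizer {g} := by
    by_contra! hc
    rw [(Subgroup.eq_top_iff' _).mpr hc, Subgroup.index_top] at hi
    omega
  have hcomm : ∀ y, ∀ k ∈ Subgroup.centralizer {g}, (y⁻¹ * g * y) * k = k * (y⁻¹ * g * y) := by
    intro y k hk
    have e := (hmem _).mp (hN.conj_mem k hk y)
    calc y⁻¹ * g * y * k = y⁻¹ * (g * (y * k * y⁻¹)) * y := by group
      _ = _ := by rw [e]; group
  have hx3 : g * x ^ 3 = x ^ 3 * g := by
    rw [← hmem, ← hi]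
    exact Subgroup.pow_index_mem _ x
  obtain ⟨b, hb⟩ : ∃ b, b = x⁻¹ * g * x := ⟨_, rfl⟩
  obtain ⟨d, hd⟩ : ∃ d, d = x⁻¹ * b * x := ⟨_, rfl⟩
  have hgx : g * x = x * b := by rw [hb]; group
  have hbx : b * x = x * d := by rw [hd]; group
  have hdx : d * x = x * g := by
    have : d * x = x⁻¹ * x⁻¹ * (g * x ^ 3) := by
      rw [hd, hb]; simp only [pow_succ, pow_zero, one_mul, mul_assoc]
    rw [this, hx3]
    simp only [pow_succ, pow_zero, one_mul, mul_assoc, inv_mul_cancel_left]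
  have hgb : g ≠ b := fun e => hx ((hmem x).mpr (by rw [hgx, ← e]))
  have hcancel : ∀ {u v u' v'}, u * x = x * u' → v * x = x * v' → u' ≠ v' → u ≠ v :=
    fun hu hv hn e => hn (mul_left_cancel (a := x) (by rw [← hu, ← hv, e]))
  have hdg : d ≠ g := hcancel hdx hgx hgb
  have hbd : b ≠ d := hcancel hbx hdx hdg
  have hconj : ∀ {u u'}, u * x = x * u' → MulAut.conj u x = x * (u' * u⁻¹) := fun hu => by
    rw [MulAut.conj_apply, hu, mul_assoc]
  have hdiv : ∀ {u v u' v'}, u * x = x * u' → v * x = x * v' →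
      (u * v⁻¹) * x = x * (u' * v'⁻¹) := by
    intro u v u' v' hu hv
    have hu' : u = x * u' * x⁻¹ := by rw [← hu]; group
    have hv' : v = x * v' * x⁻¹ := by rw [← hv]; group
    rw [hu', hv']; group
  have hz1 := hdiv hbx hgx
  have hz2 := hdiv hdx hbx
  have hz3 := hdiv hgx hdx
  have hne : ∀ {u u'}, u * x = x * u' → u ≠ u' → x ≠ MulAut.conj u x := by
    intro u u' hu hn e
    rw [hconj hu] at e
    exact hn (mul_inv_eq_one.mp (by simpa using e)).symm
  have heq : b * g⁻¹ = d * b⁻¹ ∧ d * b⁻¹ = g * d⁻¹ := by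
    rcases hO x (MulAut.conj g) (MulAut.conj b) (MulAut.conj d) with e | e | e | e | e | e
    · exact absurd e (hne hgx hgb)
    · exact absurd e (hne hbx hbd)
    · exact absurd e (hne hdx hdg)
    · rw [hconj hgx, hconj hbx, mul_right_inj] at e
      rw [e, hz2, mul_right_inj] at hz1
      exact ⟨e, hz1.symm⟩
    · rw [hconj hgx, hconj hdx, mul_right_inj] at e
      rw [e, hz3, mul_right_inj] at hz1
      exact ⟨hz1, hz1.symm.trans e⟩
    · rw [hconj hbx, hconj hdx, mul_right_inj] at e
      rw [e, hz3, mul_right_inj] at hz2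
      exact ⟨hz2.trans e.symm, e⟩
  obtain ⟨z, hz⟩ : ∃ z, z = b * g⁻¹ := ⟨_, rfl⟩
  have hbz : b = z * g := by rw [hz]; group
  have hdz : d = z * b := by rw [hz, heq.1]; group
  have hgz : g = z * d := by rw [hz, heq.1, heq.2]; group
  have hz0 : z ≠ 1 := fun e => hgb (by rw [hbz, e, one_mul])
  have hzpow : z ^ 3 = 1 := by
    rw [hdz, hbz] at hgz
    have : z ^ 3 * g = 1 * g := by
      rw [one_mul]
      conv_rhs => rw [hgz]
      simp only [pow_succ, pow_zero, one_mul, mul_assoc]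
    exact mul_right_cancel this
  have hzx : z * x = x * z := by rw [hz, hz1, heq.1]
  have hzH : Subgroup.centralizer {g} ≤ Subgroup.centralizer {z} := by
    intro k hk
    have e1 : Commute b k := by rw [hb]; exact hcomm x k hk
    have e2 : Commute g k := (hmem k).mp hk
    rw [Subgroup.mem_centralizer_singleton_iff, hz]
    exact (e1.mul_left e2.inv_left).symm
  have hzc : ∀ k, z * k = k * z := by
    have hxz : x ∈ Subgroup.centralizer {z} := by
      rw [Subgroup.mem_centralizer_singleton_iff, hzx]
    have hmul := Subgroup.relIndex_mul_index hzH
    rw [hi] at hmul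
    have htop : Subgroup.centralizer {z} = ⊤ := by
      rw [← Subgroup.index_eq_one]
      rcases (Nat.dvd_prime Nat.prime_three).mp (Dvd.intro_left _ hmul) with h | h
      · exact h
      · rw [h] at hmul
        exact absurd (Subgroup.relIndex_eq_one.mp (by omega) hxz) hx
    intro k
    have : k ∈ Subgroup.centralizer {z} := htop ▸ Subgroup.mem_top k
    exact (Subgroup.mem_centralizer_singleton_iff.mp this).symm
  exact false_of_central_commutator hO hzc hzpow hz0
    (by rw [hgx, hbz, hzc, mul_assoc] : g * x = x * g * z)

theorem eq_of_map_eq_of_odd {G : Type*} [Group G] (hO : SmallOrbits G)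
    {σ : G →* Equiv.Perm (Fin 3)} (hσ : Function.Surjective σ) {s : G}
    (hs : Equiv.Perm.sign (σ s) = -1) {α : MulAut G} (h : σ (α s) = σ s) : α s = s := by
  have key : ∀ τ : Equiv.Perm (Fin 3), Equiv.Perm.sign τ = -1 → ∃ k₁ k₂ : Equiv.Perm (Fin 3),
      τ ≠ k₁ * τ * k₁⁻¹ ∧ τ ≠ k₂ * τ * k₂⁻¹ ∧ k₁ * τ * k₁⁻¹ ≠ k₂ * τ * k₂⁻¹ := by decide
  obtain ⟨k₁, k₂, h1, h2, h3⟩ := key _ hs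
  obtain ⟨x₁, rfl⟩ := hσ k₁
  obtain ⟨x₂, rfl⟩ := hσ k₂
  simp only [← map_mul, ← map_inv] at h1 h2 h3
  rcases hO s (MulAut.conj x₁) (MulAut.conj x₂) α with e | e | e | e | e | e
  · exact absurd (congrArg σ e) h1
  · exact absurd (congrArg σ e) h2
  · exact e.symm
  · exact absurd (congrArg σ e) h3
  · exact absurd (h.symm.trans (congrArg σ e).symm) h1
  · exact absurd (h.symm.trans (congrArg σ e).symm) h2

theorem central_of_map_eq_one {G : Type*} [Group G] (hO : SmallOrbits G)
    {σ : G →* Equiv.Perm (Fin 3)} (hσ : Function.Surjective σ) {n : G} (hn : σ n = 1) (x : G) :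
    n * x = x * n := by
  have hodd : ∀ s, Equiv.Perm.sign (σ s) = -1 → n * s = s * n := by
    intro s hs
    have := eq_of_map_eq_of_odd hO hσ hs (α := MulAut.conj n) (by simp [hn])
    rwa [MulAut.conj_apply, mul_inv_eq_iff_eq_mul] at this
  rcases Int.units_eq_one_or (Equiv.Perm.sign (σ x)) with h | h
  · obtain ⟨s, hs⟩ := hσ (Equiv.swap 0 1)
    have hs1 : Equiv.Perm.sign (σ s) = -1 := by rw [hs]; decide
    have e : Commute n (s * (s⁻¹ * x)) :=
      Commute.mul_right (hodd s hs1) (hodd (s⁻¹ * x) (by simp [h, hs1]))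
    rw [mul_inv_cancel_left] at e
    exact e
  · exact hodd x h

theorem eq_one_of_sq_eq_one {G : Type*} [Group G] [Finite G] (hO : SmallOrbits G)
    {σ : G →* Equiv.Perm (Fin 3)} (hσ : Function.Surjective σ) {n : G} (hn : σ n = 1)
    (hn2 : n * n = 1) : n = 1 := by
  obtain ⟨α, hα⟩ := exists_mulAut_mul_central (Equiv.Perm.sign.comp σ)
    (central_of_map_eq_one hO hσ hn) hn2 (by simp [hn])
  obtain ⟨s, hs⟩ := hσ (Equiv.swap 0 1)
  have hs1 : Equiv.Perm.sign (σ s) = -1 := by rw [hs]; decide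
  have h1 : α s = s * n := by rw [hα]; simp [hs1]
  have := eq_of_map_eq_of_odd hO hσ hs1 (α := α) (by rw [h1, map_mul, hn, mul_one])
  simpa [h1] using this

theorem exists_odd_involution {G : Type*} [Group G] [Finite G] (hO : SmallOrbits G)
    {σ : G →* Equiv.Perm (Fin 3)} (hσ : Function.Surjective σ) :
    ∃ s : G, Equiv.Perm.sign (σ s) = -1 ∧ s * s = 1 := by
  obtain ⟨s, hs⟩ := hσ (Equiv.swap 0 1)
  have hodd : Odd (Nat.card σ.ker) := by
    rw [← Nat.not_even_iff_odd]
    intro he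
    have : Fact (Nat.Prime 2) := ⟨Nat.prime_two⟩
    obtain ⟨t, ht⟩ := exists_prime_orderOf_dvd_card' 2 he.two_dvd
    have ht2 := pow_orderOf_eq_one t
    rw [ht] at ht2
    have h1 : t = 1 := Subtype.ext (eq_one_of_sq_eq_one hO hσ t.2
      (by rw [← pow_two]; exact congrArg Subtype.val ht2))
    simp [h1] at ht
  refine ⟨s ^ Nat.card σ.ker, ?_, ?_⟩
  · rw [map_pow, map_pow, hs, Equiv.Perm.sign_swap (by decide), hodd.neg_one_pow]
  · have hk : s * s ∈ σ.ker := by rw [MonoidHom.mem_ker, map_mul, hs, Equiv.swap_mul_self]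
    have := congrArg Subtype.val (pow_card_eq_one' (x := (⟨s * s, hk⟩ : σ.ker)))
    rw [← (Commute.refl s).mul_pow]
    exact this

set_option synthInstance.maxSize 1000 in
set_option synthInstance.maxHeartbeats 200000 in
theorem conj_mul_mul_of_sign {G : Type*} [Group G] (hO : SmallOrbits G)
    {σ : G →* Equiv.Perm (Fin 3)} (hσ : Function.Surjective σ) {s : G}
    (hs : Equiv.Perm.sign (σ s) = -1) (hs2 : s * s = 1) {a b c : G}
    (ha : IsConj s a) (hb : IsConj s b) (hc : IsConj s c) : IsConj s (a * b * c) := by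
  have hodd : ∀ {a}, IsConj s a → Equiv.Perm.sign (σ a) = -1 := by
    intro a ha
    obtain ⟨k, rfl⟩ := isConj_iff.mp ha
    simp [hs]
  have hinv : ∀ {a}, IsConj s a → a * a = 1 := by
    intro a ha
    obtain ⟨k, rfl⟩ := isConj_iff.mp ha
    calc k * s * k⁻¹ * (k * s * k⁻¹) = k * (s * s) * k⁻¹ := by group
      _ = 1 := by rw [hs2]; group
  have hinj : ∀ {a b}, IsConj s a → IsConj s b → σ a = σ b → a = b := by
    intro a b ha hb h
    obtain ⟨k, rfl⟩ := isConj_iff.mp (ha.symm.trans hb)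
    exact (eq_of_map_eq_of_odd hO hσ (hodd ha) (α := MulAut.conj k) h.symm).symm
  have hconj : ∀ {a b}, IsConj s a → IsConj s b → IsConj s (a * b * a) := by
    intro a b ha hb
    refine hb.trans (isConj_iff.mpr ⟨a, ?_⟩)
    rw [inv_eq_of_mul_eq_one_left (hinv ha)]
  have key : ∀ x y z : Equiv.Perm (Fin 3), Equiv.Perm.sign x = -1 → Equiv.Perm.sign y = -1 →
      Equiv.Perm.sign z = -1 → x = y ∨ y = z ∨ x = z ∨ z = x * y * x := by decide
  rcases key _ _ _ (hodd ha) (hodd hb) (hodd hc) with e | e | e | e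
  · rw [hinj ha hb e, hinv hb, one_mul]
    exact hc
  · rw [hinj hb hc e, mul_assoc, hinv hc, mul_one]
    exact ha
  · rw [hinj ha hc e]
    exact hconj hc hb
  · rw [hinj hc (hconj ha hb) (by simpa using e), ← mul_assoc, ← mul_assoc]
    have h1 := hconj ha (hconj hb ha)
    simpa only [mul_assoc] using h1

theorem exists_hom_section {G : Type*} [Group G] [Finite G] (hO : SmallOrbits G)
    {σ : G →* Equiv.Perm (Fin 3)} (hσ : Function.Surjective σ) :
    ∃ p : Equiv.Perm (Fin 3) →* G, ∀ τ, σ (p τ) = τ := by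
  obtain ⟨s, hs, hs2⟩ := exists_odd_involution hO hσ
  have htri {a b c : G} (ha : IsConj s a) (hb : IsConj s b) (hc : IsConj s c) :=
    conj_mul_mul_of_sign hO hσ hs hs2 ha hb hc
  have hss : ∀ t, s * (s * t) = t := fun t => by rw [← mul_assoc, hs2, one_mul]
  have hinv : ∀ {a}, IsConj s a → a⁻¹ = a := by
    intro a ha
    obtain ⟨k, rfl⟩ := isConj_iff.mp ha
    rw [mul_inv_rev, mul_inv_rev, inv_inv, inv_eq_of_mul_eq_one_left hs2, mul_assoc]
  have hrefl := IsConj.refl s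
  let T : Subgroup G :=
    { carrier := {x | IsConj s x ∨ IsConj s (x * s)}
      one_mem' := Or.inr (by rw [one_mul])
      mul_mem' := by
        rintro x y (hx | hx) (hy | hy)
        · exact Or.inr (htri hx hy hrefl)
        · left; simpa [mul_assoc, hs2] using htri hx hy hrefl
        · left; simpa [mul_assoc, hss] using htri hx hrefl hy
        · right; simpa [mul_assoc, hss] using htri hx hrefl hy
      inv_mem' := by
        rintro x (hx | hx)
        · left; rwa [hinv hx]
        · right
          have e : x⁻¹ = s * (x * s) := by
            rw [← hinv hx, mul_inv_rev, inv_eq_of_mul_eq_one_left hs2, hss]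
          rw [e]
          exact htri hrefl hx hrefl }
  have hinj : Function.Injective (σ.comp T.subtype) := by
    rw [injective_iff_map_eq_one]
    rintro ⟨t, ht⟩ h
    change σ t = 1 at h
    apply Subtype.ext
    change t = 1
    rcases ht with ht | ht
    · obtain ⟨k, rfl⟩ := isConj_iff.mp ht
      have := congrArg Equiv.Perm.sign h
      simp [hs] at this
    · obtain ⟨k, hk⟩ := isConj_iff.mp ht
      have := eq_of_map_eq_of_odd hO hσ hs (α := MulAut.conj k)
        (by rw [MulAut.conj_apply, hk, map_mul, h, one_mul])
      rw [MulAut.conj_apply, hk] at this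
      simpa using this
  have hsurj : Function.Surjective (σ.comp T.subtype) := by
    have key : ∀ x y : Equiv.Perm (Fin 3), Equiv.Perm.sign x = -1 →
        (∃ k, k * x * k⁻¹ = y) ∨ ∃ k, k * x * k⁻¹ = y * x := by decide
    intro τ
    rcases key _ τ hs with ⟨k, hk⟩ | ⟨k, hk⟩
    · obtain ⟨x, rfl⟩ := hσ k
      exact ⟨⟨x * s * x⁻¹, Or.inl (isConj_iff.mpr ⟨x, rfl⟩)⟩, by simpa using hk⟩
    · obtain ⟨x, rfl⟩ := hσ k
      refine ⟨⟨x * s * x⁻¹ * s, Or.inr (isConj_iff.mpr ⟨x, ?_⟩)⟩, ?_⟩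
      · rw [mul_assoc (x * s * x⁻¹), hs2, mul_one]
      · change σ (x * s * x⁻¹ * s) = τ
        rw [map_mul, map_mul, map_mul, map_inv, hk, mul_assoc, ← map_mul, hs2, map_one, mul_one]
  let e := MulEquiv.ofBijective (σ.comp T.subtype) ⟨hinj, hsurj⟩
  exact ⟨T.subtype.comp e.symm.toMonoidHom, fun τ => e.apply_symm_apply τ⟩

theorem nonempty_mulEquiv_perm {G : Type*} [Group G] [Finite G] (hO : SmallOrbits G)
    {σ : G →* Equiv.Perm (Fin 3)} (hσ : Function.Surjective σ) :
    Nonempty (G ≃* Equiv.Perm (Fin 3)) := by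
  obtain ⟨p, hp⟩ := exists_hom_section hO hσ
  have hcen : ∀ x y, p (σ x) * x⁻¹ * y = y * (p (σ x) * x⁻¹) := fun x =>
    central_of_map_eq_one hO hσ (by rw [map_mul, hp, map_inv, mul_inv_cancel])
  obtain ⟨α, hα⟩ := exists_mulAut_of_injective
    (MonoidHom.mk' (fun x => p (σ x) * x⁻¹ * p (σ x)) fun x y => by
      calc p (σ (x * y)) * (x * y)⁻¹ * p (σ (x * y))
          = p (σ x) * (p (σ y) * y⁻¹ * (x⁻¹ * p (σ x))) * p (σ y) := by
            rw [map_mul, map_mul]; group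
        _ = _ := by rw [hcen]; group)
    fun x hx => by
      change p (σ x) * x⁻¹ * p (σ x) = 1 at hx
      have h1 := congrArg σ hx
      rw [map_mul, map_mul, hp, map_inv, mul_inv_cancel, one_mul, map_one] at h1
      simpa [h1] using hx
  change ∀ x, α x = p (σ x) * x⁻¹ * p (σ x) at hα
  have hfix : ∀ s, Equiv.Perm.sign (σ s) = -1 → α s = s := fun s hs =>
    eq_of_map_eq_of_odd hO hσ hs
      (by rw [hα, map_mul, map_mul, hp, map_inv, mul_inv_cancel, one_mul])
  obtain ⟨s, hs⟩ := hσ (Equiv.swap 0 1)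
  have hs1 : Equiv.Perm.sign (σ s) = -1 := by rw [hs]; decide
  refine ⟨MulEquiv.ofBijective σ ⟨(injective_iff_map_eq_one σ).mpr fun n hn => ?_, hσ⟩⟩
  have h1 := hfix (s * n) (by rw [map_mul, hn, mul_one, hs1])
  rw [map_mul, hfix s hs1, mul_right_inj, hα, hn, map_one, one_mul, mul_one] at h1
  exact eq_one_of_sq_eq_one hO hσ hn (inv_eq_iff_mul_eq_one.mp h1)

theorem nonempty_mulEquiv_perm_of_index {G : Type*} [Group G] [Finite G] (hO : SmallOrbits G)
    {g : G} (hi : (Subgroup.centralizer {g}).index = 3) :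
    Nonempty (G ≃* Equiv.Perm (Fin 3)) := by
  by_cases hN : (Subgroup.centralizer {g}).Normal
  · exact (false_of_centralizer_normal hO hN hi).elim
  generalize Subgroup.centralizer {g} = H at hi hN
  let e : G ⧸ H ≃ Fin 3 := Finite.equivFinOfCardEq hi
  let σ : G →* Equiv.Perm (Fin 3) := e.permCongrHom.toMonoidHom.comp (MulAction.toPermHom G (G ⧸ H))
  have hker : σ.ker = H.normalCore := by
    rw [Subgroup.normalCore_eq_ker]
    ext x
    exact e.permCongrHom.map_eq_one_iff
  refine nonempty_mulEquiv_perm hO (σ := σ) (MonoidHom.range_eq_top.mp ?_)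
  have h6 : Nat.card (Equiv.Perm (Fin 3)) = 6 := by rw [Nat.card_eq_fintype_card]; decide
  apply Subgroup.eq_top_of_card_eq
  have hd := σ.range.card_subgroup_dvd_card
  rw [← Subgroup.index_ker, hker, h6] at *
  have hmul := Subgroup.relIndex_mul_index H.normalCore_le
  rw [hi] at hmul
  have hne : H.normalCore.relIndex H ≠ 1 := fun h1 => hN (by
    rw [← le_antisymm H.normalCore_le (Subgroup.relIndex_eq_one.mp h1)]
    infer_instance)
  have := Nat.le_of_dvd (by norm_num) hd
  have : H.normalCore.relIndex H = 2 := by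
    have : H.normalCore.relIndex H ≠ 0 := fun h0 => by
      rw [h0, zero_mul] at hmul
      rw [← hmul] at hd
      omega
    omega
  omega

theorem index_centralizer_eq_ncard {G : Type*} [Group G] (g : G) :
    (Subgroup.centralizer {g}).index = {x | ∃ k, x = k * g * k⁻¹}.ncard := by
  have h := MulAction.index_stabilizer (ConjAct G) g
  have e : MulAction.orbit (ConjAct G) g = {x | ∃ k, x = k * g * k⁻¹} := by
    ext x
    constructor
    · rintro ⟨k, rfl⟩
      exact ⟨ConjAct.ofConjAct k, ConjAct.smul_def k g⟩
    · rintro ⟨k, rfl⟩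
      exact ⟨ConjAct.toConjAct k, ConjAct.toConjAct_smul k g⟩
  rw [ConjAct.stabilizer_eq_centralizer, e] at h
  exact h

theorem nonempty_mulEquiv_perm_of_not_commutative {G : Type*} [Group G] [Finite G]
    (hO : ∀ g : G, (MulAction.orbit (MulAut G) g).ncard ≤ 3) {a : G}
    (ha : (MulAction.orbit (MulAut G) a).ncard = 3) (hG : ¬ ∀ x y : G, x * y = y * x) :
    Nonempty (G ≃* Equiv.Perm (Fin 3)) := by
  have hS := smallOrbits_of_ncard_le hO
  by_cases hac : ∀ x, a * x = x * a
  · push Not at hG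
    obtain ⟨h, g, hhg⟩ := hG
    obtain ⟨β, γ, h1, h2, h3⟩ := exists_three_of_orbit_ncard ha
    have hsub : {x | ∃ k, x = k * g * k⁻¹} ⊆ MulAction.orbit (MulAut G) g := by
      rintro _ ⟨k, rfl⟩
      exact ⟨MulAut.conj k, rfl⟩
    have hle := (Set.ncard_le_ncard hsub (Set.toFinite _)).trans (hO g)
    have hkg : h * g * h⁻¹ ≠ g := fun e => hhg (mul_inv_eq_iff_eq_mul.mp e)
    have hpair : ({g, h * g * h⁻¹} : Set G) ⊆ {x | ∃ k, x = k * g * k⁻¹} := by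
      rintro _ (rfl | rfl)
      exacts [⟨1, by simp⟩, ⟨h, rfl⟩]
    have hge := Set.ncard_le_ncard hpair (Set.toFinite _)
    rw [Set.ncard_pair hkg.symm] at hge
    obtain hn | hn : {x | ∃ k, x = k * g * k⁻¹}.ncard = 2 ∨
        {x | ∃ k, x = k * g * k⁻¹}.ncard = 3 := by omega
    · have heq := Set.eq_of_subset_of_ncard_le hpair
        (by rw [hn, Set.ncard_pair hkg.symm]) (Set.toFinite _)
      refine (false_of_central_orbit hS hac rfl hkg (fun y => ?_) h1 h2 h3).elim
      have hy : y * g * y⁻¹ ∈ ({g, h * g * h⁻¹} : Set G) := heq ▸ ⟨y, rfl⟩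
      exact hy
    · exact nonempty_mulEquiv_perm_of_index hS ((index_centralizer_eq_ncard g).trans hn)
  · push Not at hac
    obtain ⟨h, hh⟩ := hac
    refine nonempty_mulEquiv_perm_of_index hS (g := a) ((index_centralizer_eq_ncard a).trans ?_)
    rw [← ha]
    congr 1
    ext x
    constructor
    · rintro ⟨k, rfl⟩
      exact ⟨MulAut.conj k, rfl⟩
    · rintro ⟨α, rfl⟩
      exact isConj_of_smallOrbits hS (fun e => hh (mul_inv_eq_iff_eq_mul.mp e).symm) α

theorem maol_congr {G H : Type*} [Group G] [Group H] (e : G ≃* H) : maol G = maol H := by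
  refine Equiv.iSup_congr e.toEquiv fun g => ?_
  have : MulAction.orbit (MulAut H) (e g) = e '' MulAction.orbit (MulAut G) g := by
    ext x
    constructor
    · rintro ⟨α, rfl⟩
      exact ⟨_, ⟨(e.trans α).trans e.symm, rfl⟩, e.apply_symm_apply _⟩
    · rintro ⟨_, ⟨α, rfl⟩, rfl⟩
      exact ⟨(e.symm.trans α).trans e, congrArg (fun y => e (α y)) (e.symm_apply_apply g)⟩
  change Nat.card (MulAction.orbit (MulAut H) (e g)) = _
  rw [this, Nat.card_image_of_injective e.injective]

theorem maol_eq_three {G : Type*} [Group G] [Fintype G] [DecidableEq G]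
    (h : ∀ g : G, (Finset.univ.filter fun x : G =>
      (x = 1 ↔ g = 1) ∧ (x * x = 1 ↔ g * g = 1)).card ≤ 3)
    {a : G} (β γ : MulAut G) (h1 : a ≠ β a) (h2 : a ≠ γ a) (h3 : β a ≠ γ a) : maol G = 3 := by
  apply le_antisymm
  · refine ciSup_le fun g => le_trans ?_ (h g)
    rw [← Set.ncard_coe_finset]
    refine Set.ncard_le_ncard ?_ (Set.toFinite _)
    rintro _ ⟨α, rfl⟩
    have hα : ∀ x, α x = 1 ↔ x = 1 := fun x => EmbeddingLike.map_eq_one_iff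
    simp [← map_mul, hα]
  · refine le_trans ?_ (le_ciSup (f := fun g : G => Nat.card (MulAction.orbit (MulAut G) g))
      (Set.finite_range _).bddAbove a)
    have hsub : ({a, β a, γ a} : Set G) ⊆ MulAction.orbit (MulAut G) a := by
      rintro x (rfl | rfl | rfl)
      exacts [MulAction.mem_orbit_self _, ⟨β, rfl⟩, ⟨γ, rfl⟩]
    have hcard : ({a, β a, γ a} : Set G).ncard = 3 := by
      rw [Set.ncard_insert_of_notMem (by simp [*]), Set.ncard_pair h3]
    rw [← hcard]
    exact Set.ncard_le_ncard hsub (Set.toFinite _)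

theorem maol_kleinFour : maol (Multiplicative (ZMod 2 × ZMod 2)) = 3 := by
  refine maol_eq_three (by decide) (a := Multiplicative.ofAdd (1, 0))
    { toFun := fun x => Multiplicative.ofAdd (x.toAdd.2, x.toAdd.1)
      invFun := fun x => Multiplicative.ofAdd (x.toAdd.2, x.toAdd.1)
      left_inv := fun _ => rfl
      right_inv := fun _ => rfl
      map_mul' := fun _ _ => rfl }
    { toFun := fun x => Multiplicative.ofAdd (x.toAdd.1, x.toAdd.1 + x.toAdd.2)
      invFun := fun x => Multiplicative.ofAdd (x.toAdd.1, x.toAdd.1 + x.toAdd.2)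
      left_inv := by unfold Function.LeftInverse; decide
      right_inv := by unfold Function.RightInverse Function.LeftInverse; decide
      map_mul' := by decide } ?_ ?_ ?_ <;> decide

theorem maol_perm_fin_three : maol (Equiv.Perm (Fin 3)) = 3 :=
  maol_eq_three (by decide) (a := Equiv.swap 0 1) (MulAut.conj (Equiv.swap 0 2))
    (MulAut.conj (Equiv.swap 1 2)) (by decide) (by decide) (by decide)

theorem stmt_15 (G : Type*) [Group G] [Finite G] :
    maol G = 3 ↔
      (Nonempty (G ≃* Multiplicative (ZMod 2 × ZMod 2)) ∨
        Nonempty (G ≃* Equiv.Perm (Fin 3))) := by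
  constructor
  · intro h
    have hO : ∀ g : G, (MulAction.orbit (MulAut G) g).ncard ≤ 3 := fun g =>
      (le_ciSup (f := fun g : G => Nat.card (MulAction.orbit (MulAut G) g))
        (Set.finite_range _).bddAbove g).trans h.le
    obtain ⟨a, ha⟩ := exists_eq_ciSup_of_finite
      (f := fun g : G => Nat.card (MulAction.orbit (MulAut G) g))
    replace ha : (MulAction.orbit (MulAut G) a).ncard = 3 := ha.trans h
    by_cases hG : ∀ x y : G, x * y = y * x
    · left
      obtain ⟨β, γ, h1, h2, h3⟩ := exists_three_of_orbit_ncard ha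
      have hS := smallOrbits_of_ncard_le hO
      have hK : IsKleinFour G := by
        let _ : CommGroup G := { ‹Group G› with mul_comm := hG }
        exact isKleinFour_of_smallOrbits hS h1 h2 h3
      exact IsKleinFour.nonempty_mulEquiv
    · exact Or.inr (nonempty_mulEquiv_perm_of_not_commutative hO ha hG)
  · rintro (⟨⟨e⟩⟩ | ⟨⟨e⟩⟩)
    · exact (maol_congr e).trans maol_kleinFour
    · exact (maol_congr e).trans maol_perm_fin_three
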